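/- Let ρ₋ > 0, ρ₊ > 0, u₋ ∈ ℝ, u₊ ∈ ℝ, β ∈ ℝ. Suppose γₙ ∈ (1,2) with γₙ → 1, and ρₙ > max(ρ₋,ρ₊) is a sequence with u₋ − u₊ = Θ_{γₙ}(ρₙ,ρ₋)·(ρₙ − ρ₋) + Θ_{γₙ}(ρₙ,ρ₊)·(ρₙ − ρ₊) for all n, where u₋ > u₊. If (ρₙ) converges to some c ∈ (0, +∞), then u₋ = u₊; consequently, since u₋ > u₊, the sequence (ρₙ) has no finite positive limit point, i.e. ρₙ → +∞. -/

import Mathlib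

open Real Filter Topology

/-- The shock-curve slope coefficient Θ_γ(a,b) from equation (4.9). -/
noncomputable def Theta (γ a b : ℝ) : ℝ :=
  Real.sqrt (((γ - 1) / 2) * (a ^ (γ - 1) - b ^ (γ - 1)) / ((a + b) * (a - b)))

/-- The exponent lies in `[0, 1]`, so the power is dominated by an affine function. -/
lemma rpow_le_one_add_self {a s : ℝ} (ha : 0 < a) (hs₀ : 0 ≤ s) (hs₁ : s ≤ 1) :
    a ^ s ≤ 1 + a := by
  rcases le_total a 1 with h | h
  · linarith [Real.rpow_le_one ha.le h hs₀]
  · have := Real.rpow_le_rpow_of_exponent_le h hs₁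
    rw [Real.rpow_one] at this
    linarith

lemma Theta_mul_sub_le {γ a b : ℝ} (hγ : γ ∈ Set.Ioo (1 : ℝ) 2) (hb : 0 < b) (hab : b < a) :
    Theta γ a b * (a - b) ≤ √((γ - 1) / 2 * (1 + a)) := by
  obtain ⟨h₁, h₂⟩ := hγ
  have hd : 0 < a - b := sub_pos.2 hab
  have hs : 0 < a + b := by linarith
  have hk : 0 ≤ (γ - 1) / 2 := by linarith
  have hP : 0 ≤ a ^ (γ - 1) - b ^ (γ - 1) :=
    sub_nonneg.2 (Real.rpow_le_rpow hb.le hab.le (by linarith))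
  have hP' : a ^ (γ - 1) - b ^ (γ - 1) ≤ 1 + a := by
    linarith [rpow_le_one_add_self (s := γ - 1) (hb.trans hab) (by linarith) (by linarith),
      Real.rpow_nonneg hb.le (γ - 1)]
  apply Real.le_sqrt_of_sq_le
  rw [Theta, mul_pow, Real.sq_sqrt (by positivity)]
  calc (γ - 1) / 2 * (a ^ (γ - 1) - b ^ (γ - 1)) / ((a + b) * (a - b)) * (a - b) ^ 2
      = (γ - 1) / 2 * (a ^ (γ - 1) - b ^ (γ - 1)) * ((a - b) / (a + b)) := by
        field_simp
    _ ≤ (γ - 1) / 2 * (a ^ (γ - 1) - b ^ (γ - 1)) :=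
        mul_le_of_le_one_right (by positivity) ((div_le_one hs).2 (by linarith))
    _ ≤ (γ - 1) / 2 * (1 + a) := by gcongr

/-- Sequential form of the blow-up argument in the proof of Lemma 4.2. -/
theorem lemma42_sequential (ρm ρp um up β : ℝ) (hρm : 0 < ρm) (hρp : 0 < ρp)
    (γ : ℕ → ℝ) (hγ : ∀ n, γ n ∈ Set.Ioo (1 : ℝ) 2)
    (hγlim : Tendsto γ atTop (𝓝 1))
    (ρ : ℕ → ℝ) (hρ : ∀ n, ρ n > max ρm ρp)
    (heq : ∀ n, um - up =
      Theta (γ n) (ρ n) ρm * (ρ n - ρm) + Theta (γ n) (ρ n) ρp * (ρ n - ρp))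
    (hu : up < um) :
    (∀ c : ℝ, c ∈ Set.Ioi (0 : ℝ) → Tendsto ρ atTop (𝓝 c) → um = up) ∧
      Tendsto ρ atTop atTop := by
  have key : Tendsto ρ atTop atTop := by
    have hδ : 0 < (um - up) ^ 2 / 2 := by
      have := sub_pos.2 hu
      positivity
    have hlim : Tendsto (fun n => γ n - 1) atTop (𝓝[>] 0) := by
      refine tendsto_nhdsWithin_iff.2 ⟨?_, Eventually.of_forall fun n => sub_pos.2 (hγ n).1⟩
      simpa using hγlim.sub_const 1
    have hbig : Tendsto (fun n => (um - up) ^ 2 / 2 * (γ n - 1)⁻¹ + -1) atTop atTop :=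
      tendsto_atTop_add_const_right _ _ (hlim.inv_tendsto_nhdsGT_zero.const_mul_atTop hδ)
    refine tendsto_atTop_mono (fun n => ?_) hbig
    obtain ⟨hm, hp⟩ := max_lt_iff.1 (hρ n)
    have hγn : 0 < γ n - 1 := sub_pos.2 (hγ n).1
    have hle : um - up ≤ 2 * √((γ n - 1) / 2 * (1 + ρ n)) := by
      linarith [heq n, Theta_mul_sub_le (hγ n) hρm hm, Theta_mul_sub_le (hγ n) hρp hp]
    have hnn : 0 ≤ (γ n - 1) / 2 * (1 + ρ n) := by
      have : 0 < 1 + ρ n := by linarith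
      positivity
    have hsq := pow_le_pow_left₀ (sub_pos.2 hu).le hle 2
    rw [mul_pow, Real.sq_sqrt hnn] at hsq
    have : (um - up) ^ 2 / 2 * (γ n - 1)⁻¹ ≤ 1 + ρ n := by
      rw [← div_eq_mul_inv, div_le_iff₀ hγn]
      linarith
    linarith
  exact ⟨fun c _ hc => (not_tendsto_nhds_of_tendsto_atTop key c hc).elim, key⟩
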